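/- Let u ∈ F_C(ℝ) and let v be a fuzzy number. Suppose u(u⁻(0)) = α₀ and u(u⁺(0)) = β₀. Then u∇v is continuous on the interval [(u∇v)⁻(α₀), (u∇v)⁺(β₀)]. -/

import Mathlib

open Set Filter Topology

/-- A fuzzy number: a function `ℝ → ℝ` taking values in `[0,1]`, whose `α`-cuts
(for `α ∈ (0,1]`) and whose `0`-cut (the closure of the support) are nonempty
compact intervals. -/
structure FuzzyNumber where
  f : ℝ → ℝ
  mem_Icc : ∀ x, f x ∈ Set.Icc (0 : ℝ) 1
  cut_isIcc : ∀ α ∈ Set.Ioc (0 : ℝ) 1, ∃ a b : ℝ, a ≤ b ∧ {x | α ≤ f x} = Set.Icc a b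
  supp_isIcc : ∃ a b : ℝ, a ≤ b ∧ closure {x | 0 < f x} = Set.Icc a b

namespace FuzzyNumber

/-- The `α`-cut of a fuzzy number; for `α = 0` it is the closure of the support. -/
noncomputable def cut (u : FuzzyNumber) (α : ℝ) : Set ℝ :=
  if α = 0 then closure {x | 0 < u.f x} else {x | α ≤ u.f x}

/-- Left endpoint `u⁻(α)` of the `α`-cut. -/
noncomputable def lo (u : FuzzyNumber) (α : ℝ) : ℝ := sInf (u.cut α)

/-- Right endpoint `u⁺(α)` of the `α`-cut. -/
noncomputable def hi (u : FuzzyNumber) (α : ℝ) : ℝ := sSup (u.cut α)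

/-- Left endpoint `u_s⁻(α)` of the strong `α`-cut: `lim_{β→α⁺} u⁻(β)` for `α < 1`,
and `u⁻(1)` for `α = 1`.  Since `u⁻` is nondecreasing, this right limit is the
infimum of `u⁻` over `(α,1]`. -/
noncomputable def slo (u : FuzzyNumber) (α : ℝ) : ℝ :=
  if α < 1 then sInf (u.lo '' Set.Ioc α 1) else u.lo 1

/-- Right endpoint `u_s⁺(α)` of the strong `α`-cut: `lim_{β→α⁺} u⁺(β)` for `α < 1`,
and `u⁺(1)` for `α = 1`. -/
noncomputable def shi (u : FuzzyNumber) (α : ℝ) : ℝ :=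
  if α < 1 then sSup (u.hi '' Set.Ioc α 1) else u.hi 1

/-- The sup-min convolution `u∇v` of two fuzzy numbers, as a function on `ℝ`:
`(u∇v)(x) = sup_y min (u y) (v (x - y))`.  Its cut functions satisfy
`(u∇v)⁻(α) = u⁻(α) + v⁻(α)` and `(u∇v)⁺(α) = u⁺(α) + v⁺(α)`. -/
noncomputable def conv (u v : FuzzyNumber) (x : ℝ) : ℝ :=
  ⨆ y : ℝ, min (u.f y) (v.f (x - y))

end FuzzyNumber

/-- `f` has left derivative `f'` at `x`. -/
def HasLeftDerivAt (f : ℝ → ℝ) (f' x : ℝ) : Prop :=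
  HasDerivWithinAt f f' (Set.Iio x) x

/-- `f` has right derivative `f'` at `x`. -/
def HasRightDerivAt (f : ℝ → ℝ) (f' x : ℝ) : Prop :=
  HasDerivWithinAt f f' (Set.Ioi x) x

namespace FuzzyNumber

theorem min_le_of_mem_Icc (u : FuzzyNumber) {p q r : ℝ} (hpq : p ≤ q) (hqr : q ≤ r) :
    min (u.f p) (u.f r) ≤ u.f q := by
  rcases le_or_gt (min (u.f p) (u.f r)) 0 with h | h
  · exact h.trans (u.mem_Icc q).1
  · obtain ⟨a, b, -, hab⟩ :=
      u.cut_isIcc _ ⟨h, (min_le_left _ _).trans (u.mem_Icc p).2⟩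
    have hp : p ∈ Icc a b := hab ▸ min_le_left (u.f p) (u.f r)
    have hr : r ∈ Icc a b := hab ▸ min_le_right (u.f p) (u.f r)
    have hq : q ∈ {x | min (u.f p) (u.f r) ≤ u.f x} :=
      hab ▸ ⟨hp.1.trans hpq, hqr.trans hr.2⟩
    exact hq

theorem cut_eq_Icc (u : FuzzyNumber) {α : ℝ} (hα : α ∈ Icc (0 : ℝ) 1) :
    u.lo α ≤ u.hi α ∧ u.cut α = Icc (u.lo α) (u.hi α) := by
  obtain ⟨a, b, hab, h⟩ : ∃ a b : ℝ, a ≤ b ∧ u.cut α = Icc a b := by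
    unfold cut
    split_ifs with h0
    · exact u.supp_isIcc
    · exact u.cut_isIcc α ⟨lt_of_le_of_ne hα.1 (Ne.symm h0), hα.2⟩
  rw [lo, hi, h, csInf_Icc hab, csSup_Icc hab]
  exact ⟨hab, rfl⟩

theorem le_of_mem_cut (u : FuzzyNumber) {α x : ℝ} (hα : 0 ≤ α) (hx : x ∈ u.cut α) :
    α ≤ u.f x := by
  rcases hα.eq_or_lt with rfl | h
  · exact (u.mem_Icc x).1
  · rwa [cut, if_neg h.ne'] at hx

theorem le_f_lo (u : FuzzyNumber) {α : ℝ} (hα : α ∈ Icc (0 : ℝ) 1) : α ≤ u.f (u.lo α) := by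
  obtain ⟨hle, hcut⟩ := u.cut_eq_Icc hα
  exact u.le_of_mem_cut hα.1 (hcut ▸ left_mem_Icc.2 hle)

theorem le_f_hi (u : FuzzyNumber) {α : ℝ} (hα : α ∈ Icc (0 : ℝ) 1) : α ≤ u.f (u.hi α) := by
  obtain ⟨hle, hcut⟩ := u.cut_eq_Icc hα
  exact u.le_of_mem_cut hα.1 (hcut ▸ right_mem_Icc.2 hle)

theorem mem_Icc_of_pos (u : FuzzyNumber) {x : ℝ} (hx : 0 < u.f x) :
    x ∈ Icc (u.lo 0) (u.hi 0) := by
  rw [← (u.cut_eq_Icc (by simp)).2, cut, if_pos rfl]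
  exact subset_closure hx

theorem lo_zero_le (u : FuzzyNumber) {α : ℝ} (hα : α ∈ Icc (0 : ℝ) 1) : u.lo 0 ≤ u.lo α := by
  rcases hα.1.eq_or_lt with rfl | h
  · exact le_rfl
  · exact (u.mem_Icc_of_pos (h.trans_le (u.le_f_lo hα))).1

theorem hi_le_hi_zero (u : FuzzyNumber) {α : ℝ} (hα : α ∈ Icc (0 : ℝ) 1) :
    u.hi α ≤ u.hi 0 := by
  rcases hα.1.eq_or_lt with rfl | h
  · exact le_rfl
  · exact (u.mem_Icc_of_pos (h.trans_le (u.le_f_hi hα))).2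

theorem min_le_conv (u v : FuzzyNumber) (x y : ℝ) : min (u.f y) (v.f (x - y)) ≤ u.conv v x :=
  le_ciSup (f := fun y => min (u.f y) (v.f (x - y)))
    ⟨1, by rintro _ ⟨z, rfl⟩; exact (min_le_left _ _).trans (u.mem_Icc z).2⟩ y

theorem conv_nonneg (u v : FuzzyNumber) (x : ℝ) : 0 ≤ u.conv v x :=
  (le_min (u.mem_Icc 0).1 (v.mem_Icc _).1).trans (u.min_le_conv v x 0)

/-- A modulus of continuity of `u` on its `0`-cut is inherited by `u∇v`. -/
theorem conv_le_conv_add (u v : FuzzyNumber) {δ ε x x' : ℝ} (hε : 0 ≤ ε)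
    (hu : ∀ y ∈ Icc (u.lo 0) (u.hi 0), ∀ y' ∈ Icc (u.lo 0) (u.hi 0),
      |y - y'| < δ → u.f y ≤ u.f y' + ε)
    (hlo : u.lo 0 + v.lo (u.f (u.lo 0)) ≤ x') (hhi : x' ≤ u.hi 0 + v.hi (u.f (u.hi 0)))
    (hx : |x - x'| < δ) : u.conv v x ≤ u.conv v x' + ε := by
  refine ciSup_le fun y => ?_
  rcases le_or_gt (u.f y) 0 with hy0 | hy0
  · linarith [min_le_left (u.f y) (v.f (x - y)), u.conv_nonneg v x']
  have hy := u.mem_Icc_of_pos hy0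
  have hab := hy.1.trans hy.2
  suffices h : ∃ y' ∈ Icc (u.lo 0) (u.hi 0), |y - y'| < δ ∧
      min (u.f y') (v.f (x - y)) ≤ v.f (x' - y') by
    obtain ⟨y', hy', hd, hv⟩ := h
    have h1 : min (u.f y') (v.f (x - y)) ≤ u.conv v x' :=
      (le_min (min_le_left _ _) hv).trans (u.min_le_conv v x' y')
    calc min (u.f y) (v.f (x - y)) ≤ min (u.f y' + ε) (v.f (x - y) + ε) :=
          min_le_min (hu y hy y' hy' hd) (by linarith)
      _ = min (u.f y') (v.f (x - y)) + ε := (min_add_add_right _ _ _)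
      _ ≤ u.conv v x' + ε := by linarith
  rw [abs_lt] at hx
  rcases lt_or_ge (y + (x' - x)) (u.lo 0) with h1 | h1
  · refine ⟨u.lo 0, left_mem_Icc.2 hab, abs_lt.2 ⟨by linarith [hy.1], by linarith⟩, ?_⟩
    exact (min_le_min_right _ (v.le_f_lo (u.mem_Icc _))).trans
      (v.min_le_of_mem_Icc (by linarith) (by linarith))
  rcases lt_or_ge (u.hi 0) (y + (x' - x)) with h2 | h2
  · refine ⟨u.hi 0, right_mem_Icc.2 hab, abs_lt.2 ⟨by linarith, by linarith [hy.2]⟩, ?_⟩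
    rw [min_comm]
    exact (min_le_min_left _ (v.le_f_hi (u.mem_Icc _))).trans
      (v.min_le_of_mem_Icc (by linarith) (by linarith))
  · refine ⟨y + (x' - x), ⟨h1, h2⟩, abs_lt.2 ⟨by linarith, by linarith⟩, ?_⟩
    rw [show x' - (y + (x' - x)) = x - y by ring]
    exact min_le_right _ _

end FuzzyNumber

/-- Theorem `cst`: if `u ∈ F_C(ℝ)`, `u(u⁻(0)) = α₀`,
`u(u⁺(0)) = β₀` and `v` is any fuzzy number, then `u∇v` is continuous on
`[(u∇v)⁻(α₀), (u∇v)⁺(β₀)]`. -/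
theorem conv_continuousOn (u v : FuzzyNumber) (α₀ β₀ : ℝ)
    (huC : ContinuousOn u.f (Set.Icc (u.lo 0) (u.hi 0)))
    (hα₀ : u.f (u.lo 0) = α₀) (hβ₀ : u.f (u.hi 0) = β₀) :
    ContinuousOn (u.conv v) (Set.Icc (u.lo α₀ + v.lo α₀) (u.hi β₀ + v.hi β₀)) := by
  subst hα₀ hβ₀
  have hlo := u.lo_zero_le (u.mem_Icc (u.lo 0))
  have hhi := u.hi_le_hi_zero (u.mem_Icc (u.hi 0))
  have huc := Metric.uniformContinuousOn_iff.1
    (isCompact_Icc.uniformContinuousOn_of_continuous huC)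
  refine UniformContinuousOn.continuousOn (Metric.uniformContinuousOn_iff.2 fun ε hε => ?_)
  obtain ⟨δ, hδ, h⟩ := huc (ε / 2) (half_pos hε)
  have hu : ∀ y ∈ Icc (u.lo 0) (u.hi 0), ∀ y' ∈ Icc (u.lo 0) (u.hi 0),
      |y - y'| < δ → u.f y ≤ u.f y' + ε / 2 := fun y hy y' hy' hd => by
    have := (abs_lt.1 (h y hy y' hy' hd)).2
    linarith
  refine ⟨δ, hδ, fun x hx x' hx' hd => ?_⟩
  have h1 := u.conv_le_conv_add v (half_pos hε).le hu (x := x) (x' := x')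
    (by linarith [hx'.1]) (by linarith [hx'.2]) hd
  have h2 := u.conv_le_conv_add v (half_pos hε).le hu (x := x') (x' := x)
    (by linarith [hx.1]) (by linarith [hx.2]) (by rwa [abs_sub_comm])
  rw [Real.dist_eq, abs_lt]
  constructor <;> linarith
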